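/- Let C ⊂ ℍ^d be a convex body, and let H be a supporting hyperplane with width_H(C) = Δ(C). Assume there exists a unique point j ∈ C at maximum distance from H. Then the orthogonal projection of j onto H belongs to H ∩ C. -/

import Mathlib

noncomputable section

namespace HypSpace

/-- Inverse hyperbolic cosine. -/
def arcosh (x : ℝ) : ℝ := Real.log (x + Real.sqrt (x ^ 2 - 1))

/-- The Minkowski bilinear form on `ℝ^{d+1}` (signature `(d,1)`, the last
coordinate being timelike). -/
def mink (d : ℕ) (x y : EuclideanSpace ℝ (Fin (d + 1))) : ℝ :=
  (∑ i : Fin d, x i.castSucc * y i.castSucc) - x (Fin.last d) * y (Fin.last d)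

/-- The hyperboloid model of `d`-dimensional hyperbolic space: the upper sheet
of the two-sheeted hyperboloid `mink x x = -1`. -/
def Pt (d : ℕ) : Type := {x : EuclideanSpace ℝ (Fin (d + 1)) // mink d x x = -1 ∧ 0 < x (Fin.last d)}

variable {d : ℕ}

/-- Hyperbolic distance between two points of `ℍ^d`. -/
def hdist (p q : Pt d) : ℝ := arcosh (-(mink d p.1 q.1))

/-- The geodesic segment between `a` and `b`, described metrically via betweenness
(hyperbolic space is uniquely geodesic). -/
def seg (a b : Pt d) : Set (Pt d) := {p | hdist a p + hdist p b = hdist a b}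

/-- A set is (geodesically) convex if it contains the segment between any two of its points. -/
def IsConvexSet (C : Set (Pt d)) : Prop := ∀ a ∈ C, ∀ b ∈ C, seg a b ⊆ C

/-- The convex hull: the smallest convex set containing `A`. -/
def chull (A : Set (Pt d)) : Set (Pt d) := ⋂₀ {C | IsConvexSet C ∧ A ⊆ C}

/-- The totally geodesic hyperplane with (spacelike) normal vector `v`. -/
def plane (v : EuclideanSpace ℝ (Fin (d + 1))) : Set (Pt d) := {p | mink d v p.1 = 0}

/-- A hyperplane of `ℍ^d`: the trace on the hyperboloid of a linear hyperplane
with spacelike unit normal. -/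
def IsHyperplane (H : Set (Pt d)) : Prop := ∃ v, mink d v v = 1 ∧ H = plane v

/-- Distance from a point to a set. -/
def distPS (p : Pt d) (S : Set (Pt d)) : ℝ := sInf (hdist p '' S)

/-- Distance between two sets. -/
def distSS (A B : Set (Pt d)) : ℝ := sInf {r | ∃ a ∈ A, ∃ b ∈ B, hdist a b = r}

/-- `h` is the orthogonal projection of `g` onto `H`: the point of `H`
realizing the distance from `g` to `H`.  For a hyperplane `H` with `a ∈ H`,
`IsProj b H a` also expresses that `H` is orthogonal to the segment `ab` at `a`. -/
def IsProj (g : Pt d) (H : Set (Pt d)) (h : Pt d) : Prop :=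
  h ∈ H ∧ ∀ k ∈ H, hdist g h ≤ hdist g k

/-- Two hyperplanes are ultraparallel if they are disjoint and not asymptotically
parallel (their distance is positive, i.e. they admit a common perpendicular). -/
def Ultraparallel (H J : Set (Pt d)) : Prop :=
  IsHyperplane H ∧ IsHyperplane J ∧ H ∩ J = ∅ ∧ 0 < distSS H J

/-- `p` is an interior point of `C`. -/
def IsIntr (C : Set (Pt d)) (p : Pt d) : Prop := ∃ ε > 0, ∀ q, hdist p q < ε → q ∈ C

/-- `p` is a boundary point of the (closed) set `C`. -/
def IsBdry (C : Set (Pt d)) (p : Pt d) : Prop := p ∈ C ∧ ¬ IsIntr C p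

/-- `C` is bounded. -/
def IsBddSet (C : Set (Pt d)) : Prop := ∃ R, ∀ a ∈ C, ∀ b ∈ C, hdist a b ≤ R

/-- `C` is closed. -/
def IsClosedSet (C : Set (Pt d)) : Prop :=
  ∀ p : Pt d, (∀ ε > 0, ∃ q ∈ C, hdist p q < ε) → p ∈ C

/-- A convex body: a compact (closed and bounded) convex set with nonempty interior. -/
def IsBody (C : Set (Pt d)) : Prop :=
  IsConvexSet C ∧ IsBddSet C ∧ IsClosedSet C ∧ ∃ p, IsIntr C p

/-- The hyperplane `H` supports `C`: it meets `C` but misses its interior. -/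
def Supports (H C : Set (Pt d)) : Prop :=
  IsHyperplane H ∧ (H ∩ C).Nonempty ∧ ∀ p, IsIntr C p → p ∉ H

/-- The width of `C` determined by `H`, as the maximum distance from `H`
to a point of `C`. -/
def width (H C : Set (Pt d)) : ℝ := sSup ((fun c => distPS c H) '' C)

/-- The width of `C` determined by `H`, as the distance from `H` to a farthest
supporting hyperplane of `C` ultraparallel to `H`. -/
def widthUP (H C : Set (Pt d)) : ℝ :=
  sSup {r | ∃ J, Supports J C ∧ Ultraparallel H J ∧ distSS H J = r}

/-- The thickness of `C`: the minimum width over supporting hyperplanes. -/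
def thickness (C : Set (Pt d)) : ℝ := sInf {r | ∃ H, Supports H C ∧ width H C = r}

/-- The diameter of `C`. -/
def diam (C : Set (Pt d)) : ℝ := sSup {r | ∃ a ∈ C, ∃ b ∈ C, hdist a b = r}

/-- A body of constant width `δ`. -/
def ConstWidth (W : Set (Pt d)) (δ : ℝ) : Prop :=
  IsBody W ∧ ∀ H, Supports H W → width H W = δ

/-- A complete set of diameter `δ`. -/
def CompleteSet (C : Set (Pt d)) (δ : ℝ) : Prop :=
  diam C = δ ∧ ∀ x, x ∉ C → diam (C ∪ {x}) > δ

/-- A body of constant diameter `δ`. -/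
def ConstDiam (C : Set (Pt d)) (δ : ℝ) : Prop :=
  diam C = δ ∧ ∀ p, IsBdry C p → ∃ p' ∈ C, hdist p p' = δ



abbrev E (d : ℕ) := EuclideanSpace ℝ (Fin (d + 1))

lemma mink_comm (x y : E d) : mink d x y = mink d y x := by
  simp only [mink, mul_comm]

lemma mink_add_left (x y z : E d) : mink d (x + y) z = mink d x z + mink d y z := by
  simp only [mink, PiLp.add_apply, add_mul, Finset.sum_add_distrib]; ring

lemma mink_smul_left (a : ℝ) (x z : E d) : mink d (a • x) z = a * mink d x z := by
  simp only [mink, PiLp.smul_apply, smul_eq_mul, mul_assoc, ← Finset.mul_sum]; ring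

lemma mink_add_right (x y z : E d) : mink d x (y + z) = mink d x y + mink d x z := by
  rw [mink_comm, mink_add_left, mink_comm y, mink_comm z]

lemma mink_smul_right (a : ℝ) (x z : E d) : mink d x (a • z) = a * mink d x z := by
  rw [mink_comm, mink_smul_left, mink_comm]

lemma mink_neg_left (x z : E d) : mink d (-x) z = -mink d x z := by
  rw [← neg_one_smul ℝ x, mink_smul_left]; ring

lemma mink_neg_right (x z : E d) : mink d x (-z) = -mink d x z := by
  rw [mink_comm, mink_neg_left, mink_comm]

lemma mink_sub_left (x y z : E d) : mink d (x - y) z = mink d x z - mink d y z := by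
  rw [sub_eq_add_neg, mink_add_left, mink_neg_left]; ring

lemma mink_sub_right (x y z : E d) : mink d x (y - z) = mink d x y - mink d x z := by
  rw [sub_eq_add_neg, mink_add_right, mink_neg_right]; ring

lemma continuous_mink {X : Type*} [TopologicalSpace X] {f g : X → E d}
    (hf : Continuous f) (hg : Continuous g) : Continuous fun x => mink d (f x) (g x) := by
  unfold mink
  fun_prop

lemma rcs (x y : E d) (hx : mink d x x < 0) :
    mink d x x * mink d y y ≤ mink d x y ^ 2 := by
  set a := x (Fin.last d) with ha
  set b := y (Fin.last d) with hb
  have ha0 : a ≠ 0 := by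
    intro h0
    have : mink d x x = ∑ i : Fin d, x i.castSucc * x i.castSucc := by
      simp only [mink, ← ha, h0]; ring
    have h2 : 0 ≤ ∑ i : Fin d, x i.castSucc * x i.castSucc :=
      Finset.sum_nonneg fun i _ => mul_self_nonneg _
    linarith
  have hz : 0 ≤ mink d (b • x - a • y) (b • x - a • y) := by
    have h0 : (b • x - a • y) (Fin.last d) = 0 := by
      simp only [PiLp.sub_apply, PiLp.smul_apply, smul_eq_mul, ← ha, ← hb]; ring
    have h2 : 0 ≤ ∑ i : Fin d, (b • x - a • y) i.castSucc * (b • x - a • y) i.castSucc :=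
      Finset.sum_nonneg fun i _ => mul_self_nonneg _
    unfold mink
    rw [h0]; linarith
  simp only [mink_sub_left, mink_sub_right, mink_smul_left, mink_smul_right] at hz
  rw [mink_comm y x] at hz
  have h1 := mul_nonneg_of_nonpos_of_nonpos hx.le (neg_nonpos.2 hz)
  have h3 : 0 < a ^ 2 := by positivity
  by_contra hc
  push Not at hc
  nlinarith [mul_pos h3 (sub_pos.2 hc), sq_nonneg (b * mink d x x - a * mink d x y)]

lemma abs_sp_lt (x : E d) (p : Pt d) (hx : mink d x x < 0) :
    |∑ i : Fin d, x i.castSucc * p.1 i.castSucc| < |x (Fin.last d) * p.1 (Fin.last d)| := by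
  have hp := p.2.1
  have hcs := Finset.sum_mul_sq_le_sq_mul_sq Finset.univ (fun i : Fin d => x i.castSucc)
    (fun i : Fin d => p.1 i.castSucc)
  simp only [mink, ← pow_two] at hx hp
  have hB : 0 ≤ ∑ i : Fin d, x i.castSucc ^ 2 := Finset.sum_nonneg fun i _ => sq_nonneg _
  have hA : 0 ≤ ∑ i : Fin d, p.1 i.castSucc ^ 2 := Finset.sum_nonneg fun i _ => sq_nonneg _
  apply sq_lt_sq.1
  nlinarith

lemma mink_neg_of (x : E d) (p : Pt d) (hx : mink d x x < 0) (h0 : 0 < x (Fin.last d)) :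
    mink d x p.1 < 0 := by
  have h := abs_sp_lt x p hx
  rw [abs_of_pos (mul_pos h0 p.2.2)] at h
  have := (abs_lt.1 h).2
  unfold mink; linarith

lemma last_pos_of (x : E d) (p : Pt d) (hx : mink d x x < 0) (h0 : mink d x p.1 < 0) :
    0 < x (Fin.last d) := by
  by_contra hc
  push Not at hc
  have h := abs_sp_lt x p hx
  rw [abs_of_nonpos (mul_nonpos_of_nonpos_of_nonneg hc p.2.2.le)] at h
  have := (abs_lt.1 h).1
  unfold mink at h0; linarith

lemma one_le (p q : Pt d) : 1 ≤ -mink d p.1 q.1 := by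
  have h := mink_neg_of p.1 q (by rw [p.2.1]; norm_num) p.2.2
  have h2 := rcs p.1 q.1 (by rw [p.2.1]; norm_num)
  rw [p.2.1, q.2.1] at h2
  nlinarith

lemma hdist_eq (p q : Pt d) : hdist p q = Real.arcosh (-mink d p.1 q.1) := rfl

lemma hdist_nonneg (p q : Pt d) : 0 ≤ hdist p q := Real.arcosh_nonneg (one_le p q)

/-- normalisation of a future timelike vector -/
def nrm (x : E d) : ℝ := Real.sqrt (-mink d x x)

lemma nrm_pos {x : E d} (hx : mink d x x < 0) : 0 < nrm x := Real.sqrt_pos.2 (by linarith)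

lemma nrm_sq {x : E d} (hx : mink d x x < 0) : nrm x ^ 2 = -mink d x x := Real.sq_sqrt (by linarith)

def mk (x : E d) (hx : mink d x x < 0) (h0 : 0 < x (Fin.last d)) : Pt d :=
  ⟨(nrm x)⁻¹ • x, by
    have := nrm_pos hx
    have h2 := nrm_sq hx
    refine ⟨?_, ?_⟩
    · rw [mink_smul_left, mink_smul_right]
      field_simp
      linarith
    · simp only [PiLp.smul_apply, smul_eq_mul]; positivity⟩

lemma mk_val (x : E d) (hx : mink d x x < 0) (h0 : 0 < x (Fin.last d)) :
    (mk x hx h0).1 = (nrm x)⁻¹ • x := rfl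

lemma norm_sq_split (x : E d) : ‖x‖ ^ 2 = mink d x x + 2 * x (Fin.last d) ^ 2 := by
  rw [EuclideanSpace.norm_sq_eq, Fin.sum_univ_castSucc]
  simp only [mink, Real.norm_eq_abs, sq_abs, ← pow_two]
  ring

lemma dist_bound (p q : Pt d) (ht : -mink d p.1 q.1 ≤ 5 / 4) :
    ‖q.1 - p.1‖ ^ 2 ≤ (32 * p.1 (Fin.last d) ^ 2 + 2) * (-mink d p.1 q.1 - 1) := by
  have h1 := one_le p q
  have hcs := Finset.sum_mul_sq_le_sq_mul_sq Finset.univ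
    (fun i : Fin d => (p.1 - q.1) i.castSucc)
    (fun i : Fin d => (p.1 + q.1) i.castSucc)
  have key : ∀ x y : E d, ∑ i : Fin d, x i.castSucc * y i.castSucc
      = mink d x y + x (Fin.last d) * y (Fin.last d) := by
    intro x y; simp [mink]
  have key2 : ∀ x : E d, ∑ i : Fin d, x i.castSucc ^ 2
      = mink d x x + x (Fin.last d) ^ 2 := by
    intro x; simp [mink, pow_two]
  rw [key, key2, key2] at hcs
  simp only [mink_sub_left, mink_sub_right, mink_add_left, mink_add_right, p.2.1, q.2.1,
    mink_comm q.1 p.1, PiLp.sub_apply, PiLp.add_apply] at hcs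
  rw [norm_sq_split]
  simp only [mink_sub_left, mink_sub_right, p.2.1, q.2.1, mink_comm q.1 p.1, PiLp.sub_apply]
  have hp := p.2.2
  have hq := q.2.2
  generalize p.1 (Fin.last d) = a at *
  generalize q.1 (Fin.last d) = b at *
  obtain ⟨t, ht'⟩ : ∃ t, t = -mink d p.1 q.1 := ⟨_, rfl⟩
  have : mink d p.1 q.1 = -t := by linarith
  rw [this] at *
  have hX : (a - b) ^ 2 * (2 + 2 * t) ≤ 2 * (t - 1) * (a + b) ^ 2 := by nlinarith
  have hX2 : (a - b) ^ 2 ≤ (t - 1) * (a + b) ^ 2 := by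
    nlinarith [sq_nonneg (a - b), sq_nonneg (a + b)]
  have hY : (a + b) ^ 2 ≤ 8 * a ^ 2 + 2 * (a - b) ^ 2 := by nlinarith [sq_nonneg (2 * a + (a - b))]
  have hX3 : (a - b) ^ 2 ≤ 16 * a ^ 2 * (t - 1) := by
    nlinarith [sq_nonneg (a - b), mul_le_mul_of_nonneg_left hY (by linarith : 0 ≤ t - 1)]
  nlinarith

lemma eq_of_le (p q : Pt d) (ht : -mink d p.1 q.1 ≤ 1) : p = q := by
  have h := dist_bound p q (by linarith)
  have h1 := one_le p q
  have h2 : -mink d p.1 q.1 - 1 = 0 := by linarith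
  rw [h2, mul_zero] at h
  have h3 : ‖q.1 - p.1‖ = 0 := by nlinarith [norm_nonneg (q.1 - p.1)]
  exact Subtype.ext (sub_eq_zero.1 (norm_eq_zero.1 h3)).symm


lemma le_of_sq_le' {a b : ℝ} (h : a ^ 2 ≤ b ^ 2) (hb : 0 ≤ b) : a ≤ b :=
  le_of_abs_le (abs_le_of_sq_le_sq h hb)

lemma combo {C : Set (Pt d)} (hC : IsConvexSet C) {a b : Pt d} (ha : a ∈ C) (hb : b ∈ C)
    {α β : ℝ} (hα : 0 ≤ α) (hβ : 0 ≤ β) (hab : 0 < α + β) :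
    ∃ p ∈ C, ∃ l : ℝ, 0 < l ∧ α • a.1 + β • b.1 = l • p.1 := by
  set z : E d := α • a.1 + β • b.1 with hz
  obtain ⟨D, hD⟩ : ∃ D, D = -mink d a.1 b.1 := ⟨_, rfl⟩
  have hD' : mink d a.1 b.1 = -D := by linarith
  have hD1 : 1 ≤ D := hD ▸ one_le a b
  have hzz : mink d z z = -(α ^ 2 + β ^ 2 + 2 * α * β * D) := by
    simp only [hz, mink_add_left, mink_add_right, mink_smul_left, mink_smul_right, a.2.1, b.2.1,
      mink_comm b.1 a.1, hD']
    ring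
  have hpos : 0 < α ^ 2 + β ^ 2 + 2 * α * β * D := by
    have : 0 ≤ α * β * (D - 1) := mul_nonneg (mul_nonneg hα hβ) (by linarith)
    nlinarith [pow_pos hab 2]
  have hneg : mink d z z < 0 := by linarith
  have hl : 0 < z (Fin.last d) := by
    have h1 := a.2.2
    have h2 := b.2.2
    simp only [hz, PiLp.add_apply, PiLp.smul_apply, smul_eq_mul]
    rcases hα.eq_or_lt with h | h
    · have : 0 < β := by linarith
      rw [← h]; nlinarith
    · nlinarith [mul_pos h h1, mul_nonneg hβ h2.le]
  have hN := nrm_pos hneg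
  have hN2 := nrm_sq hneg
  refine ⟨mk z hneg hl, ?_, nrm z, hN, ?_⟩
  · apply hC a ha b hb
    show hdist a _ + hdist _ b = hdist a b
    have e1 : -mink d a.1 (mk z hneg hl).1 = (α + β * D) / nrm z := by
      rw [mk_val, mink_smul_right]
      simp only [hz, mink_add_right, mink_smul_right, a.2.1, hD']
      field_simp; ring
    have e2 : -mink d (mk z hneg hl).1 b.1 = (α * D + β) / nrm z := by
      rw [mk_val, mink_smul_left]
      simp only [hz, mink_add_left, mink_smul_left, b.2.1, hD']
      field_simp; ring
    rw [hdist_eq, hdist_eq, hdist_eq, e1, e2, ← hD]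
    set N := nrm z
    obtain ⟨S, hS⟩ : ∃ S, S = Real.sqrt (D ^ 2 - 1) := ⟨_, rfl⟩
    have hS0 : 0 ≤ S := hS ▸ Real.sqrt_nonneg _
    have hSS : S ^ 2 = D ^ 2 - 1 := by rw [hS]; exact Real.sq_sqrt (by nlinarith)
    have s1 : Real.sqrt (((α + β * D) / N) ^ 2 - 1) = β * S / N := by
      rw [Real.sqrt_eq_iff_eq_sq]
      · field_simp; rw [hSS, hN2, hzz]; ring
      · have : ((α + β * D) / N) ^ 2 - 1 = (β * S / N) ^ 2 := by
          field_simp; rw [hSS, hN2, hzz]; ring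
        rw [this]; positivity
      · positivity
    have s2 : Real.sqrt (((α * D + β) / N) ^ 2 - 1) = α * S / N := by
      rw [Real.sqrt_eq_iff_eq_sq]
      · field_simp; rw [hSS, hN2, hzz]; ring
      · have : ((α * D + β) / N) ^ 2 - 1 = (α * S / N) ^ 2 := by
          field_simp; rw [hSS, hN2, hzz]; ring
        rw [this]; positivity
      · positivity
    unfold Real.arcosh
    rw [s1, s2, ← hS]
    have p1 : 0 < α + β * D + β * S := by
      rcases hα.eq_or_lt with h | h
      · have : 0 < β := by linarith
        rw [← h]; positivity
      · positivity
    have p2 : 0 < α * D + β + α * S := by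
      rcases hα.eq_or_lt with h | h
      · have : 0 < β := by linarith
        rw [← h]; simpa using this
      · positivity
    rw [← add_div, ← add_div, ← Real.log_mul (by positivity) (by positivity)]
    congr 1
    field_simp
    rw [hN2, hzz]
    linear_combination (α * β) * hSS
  · rw [mk_val, smul_smul, mul_inv_cancel₀ hN.ne', one_smul]

def cone (C : Set (Pt d)) : Set (E d) := {x | ∃ c ∈ C, ∃ l : ℝ, 0 < l ∧ x = l • c.1}

lemma convex_cone {C : Set (Pt d)} (hC : IsConvexSet C) : Convex ℝ (cone C) := by
  rintro x ⟨a, ha, l, hl, rfl⟩ y ⟨b, hb, m, hm, rfl⟩ α β hα hβ hab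
  obtain ⟨p, hp, k, hk, h⟩ := combo hC ha hb (α := α * l) (β := β * m) (by positivity)
    (by positivity) (by
      rcases hα.eq_or_lt with h | h
      · have : 0 < β := by linarith
        rw [← h]; positivity
      · positivity)
  exact ⟨p, hp, k, hk, by rw [smul_smul, smul_smul, h]⟩

lemma mem_of_cone {C : Set (Pt d)} {q : Pt d} (h : q.1 ∈ cone C) : q ∈ C := by
  obtain ⟨c, hc, l, hl, h⟩ := h
  have h1 := q.2.1
  rw [h, mink_smul_left, mink_smul_right, c.2.1] at h1
  have : l = 1 := by nlinarith
  rw [this, one_smul] at h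
  rw [Subtype.ext h]; exact hc

open Filter Topology in
lemma cone_of_intr {C : Set (Pt d)} {p : Pt d} (h : IsIntr C p) : p.1 ∈ interior (cone C) := by
  obtain ⟨ε, hε, h⟩ := h
  rw [mem_interior_iff_mem_nhds]
  have c1 : Continuous fun y : E d => mink d y y := continuous_mink continuous_id continuous_id
  have c2 : Continuous fun y : E d => mink d p.1 y := continuous_mink continuous_const continuous_id
  have c3 : Continuous fun y : E d => y (Fin.last d) := by fun_prop
  have e1 : ∀ᶠ y in 𝓝 p.1, mink d y y < 0 :=
    c1.continuousAt.eventually_lt continuousAt_const (by simp [p.2.1])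
  have e2 : ∀ᶠ y in 𝓝 p.1, 0 < y (Fin.last d) :=
    continuousAt_const.eventually_lt c3.continuousAt p.2.2
  have c4 : ContinuousAt (fun y : E d => -mink d p.1 y / nrm y) p.1 := by
    apply ContinuousAt.div
    · exact c2.neg.continuousAt
    · exact (c1.neg.sqrt).continuousAt
    · exact (nrm_pos (by simp [p.2.1])).ne'
  have e3 : ∀ᶠ y in 𝓝 p.1, -mink d p.1 y / nrm y < Real.cosh ε := by
    apply c4.eventually_lt continuousAt_const
    have := Real.one_lt_cosh.2 hε.ne'
    simpa [nrm, p.2.1] using this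
  filter_upwards [e1, e2, e3] with y h1 h2 h3
  refine ⟨mk y h1 h2, h _ ?_, nrm y, nrm_pos h1, ?_⟩
  · rw [hdist_eq, ← Real.arcosh_cosh hε.le, Real.arcosh_lt_arcosh (by linarith [one_le p (mk y h1 h2)])
      (Real.cosh_pos _), mk_val, mink_smul_right]
    convert h3 using 1
    have := nrm_pos h1
    field_simp
  · rw [mk_val, smul_smul, mul_inv_cancel₀ (nrm_pos h1).ne', one_smul]

open Filter Topology in
lemma intr_of_cone {C : Set (Pt d)} {p : Pt d} (h : p.1 ∈ interior (cone C)) : IsIntr C p := by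
  rw [mem_interior_iff_mem_nhds, Metric.mem_nhds_iff] at h
  obtain ⟨r, hr, h⟩ := h
  set K := 32 * p.1 (Fin.last d) ^ 2 + 2 with hK
  have hK0 : 0 < K := by positivity
  set η := min (1 / 4) (r ^ 2 / (2 * K)) with hη
  have hη0 : 0 < η := by positivity
  refine ⟨Real.arcosh (1 + η), Real.arcosh_pos (by linarith), fun q hq => ?_⟩
  rw [hdist_eq, Real.arcosh_lt_arcosh (by linarith [one_le p q]) (by linarith)] at hq
  have h1 : η ≤ 1 / 4 := min_le_left _ _
  have h2 : η ≤ r ^ 2 / (2 * K) := min_le_right _ _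
  have hb := dist_bound p q (by linarith)
  apply mem_of_cone
  apply h
  rw [mem_ball_iff_norm]
  apply lt_of_pow_lt_pow_left₀ 2 hr.le
  calc _ ≤ K * (-mink d p.1 q.1 - 1) := hb
    _ ≤ K * (r ^ 2 / (2 * K)) := by gcongr; linarith
    _ = r ^ 2 / 2 := by field_simp
    _ < r ^ 2 := by have := pow_pos hr 2; linarith

lemma intr_mem {C : Set (Pt d)} {p : Pt d} (h : IsIntr C p) : p ∈ C :=
  mem_of_cone (interior_subset (cone_of_intr h))

/-- A functional nonnegative on `C` does not vanish at interior points. -/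
lemma pos_of_intr {C : Set (Pt d)} {p : Pt d} (h : IsIntr C p) (w : E d) (hw : 0 < mink d w w)
    (hC : ∀ c ∈ C, 0 ≤ mink d w c.1) : mink d w p.1 ≠ 0 := by
  intro h0
  have h1 := mem_interior_iff_mem_nhds.1 (cone_of_intr h)
  have hc : Continuous fun t : ℝ => p.1 - t • w := by fun_prop
  have h2 : Filter.Tendsto (fun t : ℝ => p.1 - t • w) (nhdsWithin 0 (Set.Ioi 0)) (nhds p.1) := by
    have := hc.tendsto 0
    simp only [zero_smul, sub_zero] at this
    exact this.mono_left nhdsWithin_le_nhds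
  obtain ⟨t, ht, ht0⟩ := ((h2.eventually h1).and self_mem_nhdsWithin).exists
  obtain ⟨c, hc, l, hl, h⟩ := ht
  have h5 : mink d w (p.1 - t • w) = mink d w (l • c.1) := by rw [h]
  rw [mink_sub_right, mink_smul_right, mink_smul_right, h0] at h5
  have := mul_pos ht0 hw
  have := mul_nonneg hl.le (hC c hc)
  linarith

/-- Support implies one-sidedness. -/
lemma one_side {C : Set (Pt d)} (hC : IsConvexSet C) {v : E d} 
    (hv : ∀ q, IsIntr C q → mink d v q.1 ≠ 0) {p : Pt d} (hp : IsIntr C p)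
    (hp0 : 0 < mink d v p.1) : ∀ c ∈ C, 0 ≤ mink d v c.1 := by
  intro c hc
  by_contra hneg
  push Not at hneg
  set A := mink d v p.1
  set B := -mink d v c.1 with hB
  have hB0 : 0 < B := by linarith
  have hz : (B / (A + B)) • p.1 + (A / (A + B)) • c.1 ∈ interior (cone C) := by
    apply (convex_cone hC).openSegment_interior_self_subset_interior (cone_of_intr hp)
      (y := c.1) ⟨c, hc, 1, one_pos, by simp⟩
    exact ⟨_, _, by positivity, by positivity, by field_simp; ring, rfl⟩
  obtain ⟨q, hq, l, hl, h⟩ := interior_subset hz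
  have h0 : l * mink d v q.1 = 0 := by
    rw [← mink_smul_right, ← h, mink_add_right, mink_smul_right, mink_smul_right]
    have : mink d v c.1 = -B := by rw [hB]; ring
    rw [this]
    change B / (A + B) * A + A / (A + B) * -B = 0
    field_simp; ring
  have h1 : mink d v q.1 = 0 := by
    rcases mul_eq_zero.1 h0 with h | h
    · linarith
    · exact h
  refine hv q (intr_of_cone ?_) h1
  rw [h] at hz
  rw [mem_interior_iff_mem_nhds] at hz ⊢
  have hcont : Continuous fun y : E d => l • y := by fun_prop
  filter_upwards [hcont.continuousAt.eventually hz] with y hy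
  obtain ⟨c', hc', m, hm, h'⟩ := hy
  refine ⟨c', hc', l⁻¹ * m, by positivity, ?_⟩
  rw [mul_smul, ← h', smul_smul, inv_mul_cancel₀ hl.ne', one_smul]

/-- compactness -/
lemma compact_image {C : Set (Pt d)} (hb : IsBddSet C) (hcl : IsClosedSet C) (a : Pt d)
    (ha : a ∈ C) : IsCompact ((fun c : Pt d => (c.1 : E d)) '' C) := by
  apply Metric.isCompact_of_isClosed_isBounded
  · rw [← isSeqClosed_iff_isClosed]
    intro x y hx hxy
    have c1 : Continuous fun y : E d => mink d y y := continuous_mink continuous_id continuous_id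
    have c3 : Continuous fun y : E d => y (Fin.last d) := by fun_prop
    have hyy : mink d y y = -1 := by
      have t1 := (c1.tendsto y).comp hxy
      refine tendsto_nhds_unique t1 ?_
      apply tendsto_const_nhds.congr
      intro n
      obtain ⟨c, hc, h⟩ := hx n
      simp only [Function.comp, ← h]; exact c.2.1.symm
    have hy0 : 0 ≤ y (Fin.last d) := by
      refine ge_of_tendsto' ((c3.tendsto y).comp hxy) ?_
      intro n
      obtain ⟨c, hc, h⟩ := hx n
      simp only [Function.comp, ← h]; exact c.2.2.le
    have hy1 : 0 < y (Fin.last d) := by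
      rcases hy0.eq_or_lt with h | h
      · have := norm_sq_split y
        rw [hyy, ← h] at this
        nlinarith [sq_nonneg ‖y‖]
      · exact h
    let q : Pt d := ⟨y, hyy, hy1⟩
    refine ⟨q, hcl q ?_, rfl⟩
    intro ε hε
    have c2 : Continuous fun z : E d => -mink d y z :=
      (continuous_mink continuous_const continuous_id).neg
    have t2 := (c2.tendsto y).comp hxy
    have : ∀ᶠ n in Filter.atTop, ((fun z : E d => -mink d y z) ∘ x) n < Real.cosh ε := by
      apply t2.eventually_lt_const
      rw [hyy]; simpa using Real.one_lt_cosh.2 hε.ne'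
    obtain ⟨n, hn⟩ := this.exists
    obtain ⟨c, hc, h⟩ := hx n
    refine ⟨c, hc, ?_⟩
    rw [hdist_eq, ← Real.arcosh_cosh hε.le, Real.arcosh_lt_arcosh (by linarith [one_le q c])
      (Real.cosh_pos _)]
    simpa [← h] using hn
  · obtain ⟨R, hR⟩ := hb
    have hR0 : 0 ≤ R := (hdist_nonneg a a).trans (hR a ha a ha)
    rw [isBounded_iff_forall_norm_le]
    set a0 := a.1 (Fin.last d) with ha0
    set A := Real.sqrt (∑ i : Fin d, a.1 i.castSucc ^ 2) with hA
    have hA2 : A ^ 2 = a0 ^ 2 - 1 := by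
      rw [hA, Real.sq_sqrt (Finset.sum_nonneg fun i _ => sq_nonneg _)]
      have := a.2.1
      simp only [mink, ← pow_two] at this
      linarith
    have hA0 : 0 ≤ A := Real.sqrt_nonneg _
    have ha0p : 0 < a0 := a.2.2
    set T := Real.cosh R * (a0 + A) with hT
    have hT0 : 0 ≤ T := by have := Real.cosh_pos R; positivity
    refine ⟨2 * T, ?_⟩
    rintro _ ⟨b, hb, rfl⟩
    have h1 := hR a ha b hb
    rw [hdist_eq, ← Real.arcosh_cosh hR0, Real.arcosh_le_arcosh (by linarith [one_le a b])
      (Real.cosh_pos _)] at h1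
    have hb0 := b.2.2
    have hbb := b.2.1
    have hcs := Finset.sum_mul_sq_le_sq_mul_sq Finset.univ (fun i : Fin d => a.1 i.castSucc)
      (fun i : Fin d => b.1 i.castSucc)
    rw [← Real.sq_sqrt (Finset.sum_nonneg fun i _ => sq_nonneg (a.1 (Fin.castSucc i))), ← hA] at hcs
    have hn := norm_sq_split b.1
    rw [hbb] at hn
    unfold mink at h1
    simp only [mink, ← pow_two] at hbb
    have hB : ∑ i : Fin d, b.1 i.castSucc ^ 2 ≤ b.1 (Fin.last d) ^ 2 := by linarith
    generalize b.1 (Fin.last d) = b0 at *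
    generalize ∑ i : Fin d, a.1 i.castSucc * b.1 i.castSucc = S at *
    have hS : S ≤ A * b0 := by
      apply le_of_sq_le' _ (by positivity)
      calc S ^ 2 ≤ _ := hcs
        _ ≤ A ^ 2 * b0 ^ 2 := by gcongr
        _ = _ := by ring
    have h3 : b0 * (a0 - A) ≤ Real.cosh R := by linarith
    have h4 : b0 ≤ T := by
      have : b0 * (a0 - A) * (a0 + A) ≤ Real.cosh R * (a0 + A) := by gcongr
      have e : b0 * (a0 - A) * (a0 + A) = b0 := by linear_combination (-b0) * hA2
      rw [e] at this; exact this
    apply le_of_sq_le' _ (by positivity)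
    nlinarith

lemma foot_exists (v : E d) (hv : mink d v v = 1) (c : Pt d) :
    ∃ k ∈ plane v, c.1 - mink d v c.1 • v = Real.sqrt (1 + mink d v c.1 ^ 2) • k.1 := by
  set s := mink d v c.1 with hs
  set x : E d := c.1 - s • v with hx
  have hxx : mink d x x = -(1 + s ^ 2) := by
    simp only [hx, mink_sub_left, mink_sub_right, mink_smul_left, mink_smul_right, c.2.1, hv,
      mink_comm c.1 v, ← hs]
    ring
  have hxc : mink d x c.1 = -(1 + s ^ 2) := by
    simp only [hx, mink_sub_left, mink_smul_left, c.2.1, ← hs]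
    ring
  have hneg : mink d x x < 0 := by rw [hxx]; nlinarith [sq_nonneg s]
  have h0 := last_pos_of x c hneg (by rw [hxc]; nlinarith [sq_nonneg s])
  refine ⟨mk x hneg h0, ?_, ?_⟩
  · show mink d v _ = 0
    rw [mk_val, mink_smul_right, hx, mink_sub_right, mink_smul_right, hv, ← hs]
    ring
  · have : nrm x = Real.sqrt (1 + s ^ 2) := by rw [nrm, hxx, neg_neg]
    rw [mk_val, ← this, smul_smul, mul_inv_cancel₀ (nrm_pos hneg).ne', one_smul]

lemma mink_foot {v : E d} {c k : Pt d} {N : ℝ}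
    (h : c.1 - mink d v c.1 • v = N • k.1) {q : Pt d} (hq : q ∈ plane v) :
    mink d c.1 q.1 = N * mink d k.1 q.1 := by
  have hq : mink d v q.1 = 0 := hq
  rw [← mink_smul_left, ← h, mink_sub_left, mink_smul_left, hq]; ring

lemma one_le_sqrt (s : ℝ) : 1 ≤ Real.sqrt (1 + s ^ 2) := by
  rw [Real.one_le_sqrt]; nlinarith [sq_nonneg s]

lemma distPS_eq (v : E d) (hv : mink d v v = 1) (c : Pt d) :
    distPS c (plane v) = Real.arcosh (Real.sqrt (1 + mink d v c.1 ^ 2)) := by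
  obtain ⟨k, hk, h⟩ := foot_exists v hv c
  have h1 := one_le_sqrt (mink d v c.1)
  set N := Real.sqrt (1 + mink d v c.1 ^ 2)
  apply IsLeast.csInf_eq
  constructor
  · refine ⟨k, hk, ?_⟩
    rw [hdist_eq, mink_foot h hk, k.2.1]; simp
  · rintro _ ⟨q, hq, rfl⟩
    have := one_le k q
    rw [hdist_eq, Real.arcosh_le_arcosh (by linarith) (by linarith [one_le c q]), mink_foot h hq]
    nlinarith

lemma proj_eq (v : E d) (hv : mink d v v = 1) (c h : Pt d) (hp : IsProj c (plane v) h) :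
    c.1 - mink d v c.1 • v = Real.sqrt (1 + mink d v c.1 ^ 2) • h.1 := by
  obtain ⟨k, hk, e⟩ := foot_exists v hv c
  have h1 := one_le_sqrt (mink d v c.1)
  have h2 := hp.2 k hk
  rw [hdist_eq, hdist_eq, Real.arcosh_le_arcosh (by linarith [one_le c h])
    (by linarith [one_le c k]), mink_foot e hk, mink_foot e hp.1, k.2.1] at h2
  have : k = h := eq_of_le k h (by nlinarith)
  rw [← this]; exact e

lemma arc_le {s t : ℝ} : Real.arcosh (Real.sqrt (1 + s ^ 2)) ≤ Real.arcosh (Real.sqrt (1 + t ^ 2))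
    ↔ s ^ 2 ≤ t ^ 2 := by
  rw [Real.arcosh_le_arcosh (by linarith [one_le_sqrt s]) (by linarith [one_le_sqrt t]),
    Real.sqrt_le_sqrt_iff (by positivity)]
  constructor <;> intro h <;> linarith

lemma small_t {X : Set (E d)} (hX : IsCompact X) {f g : E d → ℝ} (hf : Continuous f)
    (hg : Continuous g) (h0 : ∀ x ∈ X, 0 ≤ f x) (h1 : ∀ x ∈ X, f x = 0 → 0 < g x) :
    ∃ t0 > 0, ∀ t, 0 < t → t < t0 → ∀ x ∈ X, 0 ≤ f x + t * g x := by
  have hZ : IsCompact (X ∩ {x | g x ≤ 0}) :=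
    hX.inter_right (isClosed_le hg continuous_const)
  rcases (X ∩ {x | g x ≤ 0}).eq_empty_or_nonempty with he | hne
  · refine ⟨1, one_pos, fun t ht _ x hx => ?_⟩
    have : 0 < g x := by
      by_contra hc
      have : x ∈ X ∩ {x | g x ≤ 0} := ⟨hx, not_lt.1 hc⟩
      rw [he] at this; exact this
    have := h0 x hx
    positivity
  · obtain ⟨y, hy, hmin⟩ := hZ.exists_isMinOn hne hf.continuousOn
    obtain ⟨z, hz, hminz⟩ := hZ.exists_isMinOn hne hg.continuousOn
    have hm : 0 < f y := by
      rcases (h0 y hy.1).eq_or_lt with h | h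
      · have := h1 y hy.1 h.symm
        have := hy.2
        simp only [Set.mem_ofPred_eq] at this
        linarith
      · exact h
    have hz2 : g z ≤ 0 := hz.2
    refine ⟨f y / (1 - g z), div_pos hm (by linarith), fun t ht ht2 x hx => ?_⟩
    rw [lt_div_iff₀ (by linarith)] at ht2
    rcases le_or_gt (g x) 0 with h | h
    · have a1 : f y ≤ f x := hmin ⟨hx, h⟩
      have a2 : g z ≤ g x := hminz ⟨hx, h⟩
      nlinarith
    · have := h0 x hx
      positivity

lemma riesz (f : E d →L[ℝ] ℝ) : ∃ u : E d, ∀ x, mink d u x = f x := by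
  obtain ⟨y, hy⟩ := (InnerProductSpace.toDual ℝ (E d)).surjective f
  refine ⟨WithLp.toLp 2 (fun i => if i = Fin.last d then -y i else y i), fun x => ?_⟩
  rw [← hy, InnerProductSpace.toDual_apply_apply, PiLp.inner_apply, Fin.sum_univ_castSucc]
  simp [mink, Fin.castSucc_ne_last, mul_comm]

lemma separate {K : Set (Pt d)} (hK : IsCompact ((fun c : Pt d => (c.1 : E d)) '' K))
    (hc : ∀ a ∈ K, ∀ b ∈ K, ∀ α β : ℝ, 0 ≤ α → 0 ≤ β → 0 < α + β →
      ∃ p ∈ K, ∃ l : ℝ, 0 < l ∧ α • a.1 + β • b.1 = l • p.1)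
    (h : Pt d) (hh : h ∉ K) :
    ∃ u : E d, mink d u h.1 < 0 ∧ ∀ c ∈ K, 0 < mink d u c.1 := by
  let φ : E d → E d := fun x => (x (Fin.last d))⁻¹ • x
  have hφ : ContinuousOn φ ((fun c : Pt d => (c.1 : E d)) '' K) := by
    have c3 : Continuous fun y : E d => y (Fin.last d) := by fun_prop
    have c4 : ContinuousOn (fun y : E d => (y (Fin.last d))⁻¹)
        ((fun c : Pt d => (c.1 : E d)) '' K) := by
      apply c3.continuousOn.inv₀
      rintro _ ⟨c, _, rfl⟩
      exact c.2.2.ne'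
    exact c4.smul continuousOn_id
  have hcomp := hK.image_of_continuousOn hφ
  set T := φ '' ((fun c : Pt d => (c.1 : E d)) '' K) with hT
  have hlast : ∀ l : ℝ, 0 < l → ∀ p : Pt d, (l • p.1) (Fin.last d) = 1 →
      l = (p.1 (Fin.last d))⁻¹ := by
    intro l hl p hp
    simp only [PiLp.smul_apply, smul_eq_mul] at hp
    exact eq_inv_of_mul_eq_one_left hp
  have hconv : Convex ℝ T := by
    rintro _ ⟨_, ⟨a, ha, rfl⟩, rfl⟩ _ ⟨_, ⟨b, hb, rfl⟩, rfl⟩ α β hα hβ hab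
    have ha0 := a.2.2
    have hb0 := b.2.2
    obtain ⟨p, hp, l, hl, e⟩ := hc a ha b hb (α * (a.1 (Fin.last d))⁻¹)
      (β * (b.1 (Fin.last d))⁻¹) (by positivity) (by positivity) (by
        rcases hα.eq_or_lt with h | h
        · have : 0 < β := by linarith
          rw [← h]; positivity
        · positivity)
    refine ⟨p.1, ⟨p, hp, rfl⟩, ?_⟩
    have hl1 := hlast l hl p (by
      rw [← e]
      simp only [PiLp.add_apply, PiLp.smul_apply, smul_eq_mul]
      field_simp
      exact hab)
    show (p.1 (Fin.last d))⁻¹ • p.1 = α • ((a.1 (Fin.last d))⁻¹ • a.1)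
      + β • ((b.1 (Fin.last d))⁻¹ • b.1)
    rw [smul_smul, smul_smul, e, hl1]
  have hnot : φ h.1 ∉ T := by
    rintro ⟨_, ⟨p, hp, rfl⟩, e⟩
    apply hh
    have h0 := h.2.2
    have hp0 := p.2.2
    apply mem_of_cone
    refine ⟨p, hp, h.1 (Fin.last d) * (p.1 (Fin.last d))⁻¹, by positivity, ?_⟩
    have e : (p.1 (Fin.last d))⁻¹ • p.1 = (h.1 (Fin.last d))⁻¹ • h.1 := e
    rw [mul_smul, e, smul_smul, mul_inv_cancel₀ h0.ne', one_smul]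
  obtain ⟨f, r, hf1, hf2⟩ := geometric_hahn_banach_point_closed hconv hcomp.isClosed hnot
  obtain ⟨u, hu⟩ := riesz (f - r • (EuclideanSpace.proj (Fin.last d) : E d →L[ℝ] ℝ))
  have hu' : ∀ x : Pt d, mink d u x.1 = x.1 (Fin.last d) * (f (φ x.1) - r) := by
    intro x
    have hx := x.2.2
    rw [hu]
    simp only [φ, map_smul, smul_eq_mul, _root_.sub_apply,
      _root_.smul_apply]
    field_simp
    rfl
  refine ⟨u, ?_, fun c hc => ?_⟩
  · rw [hu']; exact mul_neg_of_pos_of_neg h.2.2 (by linarith)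
  · rw [hu']; exact mul_pos c.2.2 (by linarith [hf2 _ ⟨_, ⟨c, hc, rfl⟩, rfl⟩])

lemma width_nonneg (H C : Set (Pt d)) : 0 ≤ width H C := by
  apply Real.sSup_nonneg
  rintro _ ⟨c, _, rfl⟩
  apply Real.sInf_nonneg
  rintro _ ⟨q, _, rfl⟩
  exact hdist_nonneg _ _

lemma plane_neg (v : E d) : plane (-v) = plane v := by
  ext p; simp [plane, mink_neg_left]

/-- Given a normal `z`, nonnegative on `C`, of width `≤ M / |z|`, there is a supporting
hyperplane at least as good. -/
lemma thickness_le {C : Set (Pt d)} (hX : IsCompact ((fun c : Pt d => (c.1 : E d)) '' C))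
    {j : Pt d} (hj : j ∈ C) (z : E d) (hz : 0 < mink d z z) (h0 : ∀ c ∈ C, 0 ≤ mink d z c.1)
    {M : ℝ} (hM : ∀ c ∈ C, mink d z c.1 ≤ M) :
    thickness C ≤ Real.arcosh (Real.sqrt (1 + (M / Real.sqrt (mink d z z)) ^ 2)) := by
  have hM0 : 0 ≤ M := (h0 j hj).trans (hM j hj)
  have c1 : Continuous fun y : E d => mink d z y := continuous_mink continuous_const continuous_id
  have c2 : Continuous fun y : E d => -mink d j.1 y :=
    (continuous_mink continuous_const continuous_id).neg
  have hcon : ContinuousOn (fun y : E d => mink d z y / -mink d j.1 y)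
      ((fun c : Pt d => (c.1 : E d)) '' C) := by
    apply c1.continuousOn.div c2.continuousOn
    rintro _ ⟨c, _, rfl⟩
    have := one_le j c
    intro h; simp only at h; linarith
  obtain ⟨_, ⟨q, hq, rfl⟩, hmin⟩ := hX.exists_isMinOn ⟨_, ⟨j, hj, rfl⟩⟩ hcon
  obtain ⟨r, hr⟩ : ∃ r, r = mink d z q.1 / -mink d j.1 q.1 := ⟨_, rfl⟩
  have hjq := one_le j q
  have hr0 : 0 ≤ r := by rw [hr]; exact div_nonneg (h0 q hq) (by linarith)
  have hmin' : ∀ c ∈ C, r * (-mink d j.1 c.1) ≤ mink d z c.1 := by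
    intro c hc
    have h1 : mink d z q.1 / -mink d j.1 q.1 ≤ mink d z c.1 / -mink d j.1 c.1 :=
      hmin ⟨c, hc, rfl⟩
    rw [← hr, le_div_iff₀ (by linarith [one_le j c])] at h1
    exact h1
  have hrj : r ≤ mink d z j.1 := by
    have := hmin' j hj
    rw [j.2.1] at this; linarith
  set y : E d := z + r • j.1 with hy
  have hyc : ∀ c : Pt d, mink d y c.1 = mink d z c.1 + r * mink d j.1 c.1 := by
    intro c; rw [hy, mink_add_left, mink_smul_left]
  have hyy : mink d z z ≤ mink d y y := by
    simp only [hy, mink_add_left, mink_add_right, mink_smul_left, mink_smul_right, j.2.1,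
      mink_comm j.1 z]
    nlinarith
  have hyp : 0 < mink d y y := by linarith
  set n := Real.sqrt (mink d y y) with hn
  have hn0 : 0 < n := Real.sqrt_pos.2 hyp
  have hn2 : n ^ 2 = mink d y y := Real.sq_sqrt hyp.le
  set w : E d := n⁻¹ • y with hw
  have hww : mink d w w = 1 := by
    rw [hw, mink_smul_left, mink_smul_right, ← hn2]; field_simp
  have hwc : ∀ c ∈ C, 0 ≤ mink d w c.1 := by
    intro c hc
    rw [hw, mink_smul_left, hyc]
    have := hmin' c hc
    exact mul_nonneg (by positivity) (by linarith)
  have hsup : Supports (plane w) C := by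
    refine ⟨⟨w, hww, rfl⟩, ⟨q, ?_, hq⟩, fun p hp hpw => ?_⟩
    · show mink d w q.1 = 0
      rw [hw, mink_smul_left, hyc, hr]
      have : -mink d j.1 q.1 ≠ 0 := by linarith
      have : mink d j.1 q.1 ≠ 0 := by linarith
      field_simp; ring
    · exact pos_of_intr hp w (by rw [hww]; exact one_pos) hwc hpw
  calc thickness C ≤ width (plane w) C := by
        apply csInf_le
        · refine ⟨0, ?_⟩
          rintro _ ⟨H, _, rfl⟩
          exact width_nonneg _ _
        · exact ⟨_, hsup, rfl⟩
    _ ≤ _ := by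
        apply csSup_le (Set.Nonempty.image _ ⟨j, hj⟩)
        rintro _ ⟨c, hc, rfl⟩
        simp only
        rw [distPS_eq w hww, arc_le]
        have h1 := hwc c hc
        apply pow_le_pow_left₀ h1
        rw [hw, mink_smul_left, ← div_eq_inv_mul]
        have h2 : mink d y c.1 ≤ M := by
          rw [hyc]
          have := hM c hc
          have := one_le j c
          nlinarith
        have h3 : 0 < Real.sqrt (mink d z z) := Real.sqrt_pos.2 hz
        have h4 : Real.sqrt (mink d z z) ≤ n := Real.sqrt_le_sqrt hyy
        gcongr

lemma main_aux {C : Set (Pt d)} (hC : IsBody C) (v : E d) (hv : mink d v v = 1)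
    (hH : Supports (plane v) C) (hmin : width (plane v) C = thickness C)
    (j : Pt d) (hjC : j ∈ C) (hjfar : distPS j (plane v) = width (plane v) C)
    (huniq : ∀ j' ∈ C, distPS j' (plane v) = width (plane v) C → j' = j)
    (h : Pt d) (hproj : IsProj j (plane v) h) (p : Pt d) (hp : IsIntr C p)
    (hp0 : 0 < mink d v p.1) : h ∈ C := by
  have hside := one_side hC.1 (v := v) (fun q hq h0 => hH.2.2 q hq h0) hp hp0
  have hX := compact_image hC.2.1 hC.2.2.1 j hjC
  have c1 : ∀ w : E d, Continuous fun y : E d => mink d w y :=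
    fun w => continuous_mink continuous_const continuous_id
  -- farthest point
  have hfar : ∀ c ∈ C, mink d v c.1 ^ 2 ≤ mink d v j.1 ^ 2 := by
    intro c hc
    rw [← arc_le, ← distPS_eq v hv, ← distPS_eq v hv, hjfar]
    refine le_csSup ?_ (Set.mem_image_of_mem _ hc)
    obtain ⟨_, ⟨q, hq, rfl⟩, hmax⟩ := hX.exists_isMaxOn ⟨_, ⟨j, hjC, rfl⟩⟩ (c1 v).continuousOn
    refine ⟨distPS q (plane v), ?_⟩
    rintro _ ⟨c, hc, rfl⟩
    simp only
    rw [distPS_eq v hv, distPS_eq v hv, arc_le]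
    exact pow_le_pow_left₀ (hside c hc) (hmax ⟨c, hc, rfl⟩) 2
  obtain ⟨s, hs⟩ : ∃ s, s = mink d v j.1 := ⟨_, rfl⟩
  have hs0 : 0 ≤ s := hs ▸ hside j hjC
  have hle : ∀ c ∈ C, mink d v c.1 ≤ s := fun c hc =>
    le_of_sq_le' (hs ▸ hfar c hc) hs0
  have hspos : 0 < s := hp0.trans_le (hle p (intr_mem hp))
  have huq : ∀ c ∈ C, mink d v c.1 = s → c = j := by
    intro c hc e
    apply huniq c hc
    rw [← hjfar, distPS_eq v hv, distPS_eq v hv, e, hs]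
  have hfoot := proj_eq v hv j h hproj
  rw [← hs] at hfoot
  have hN := one_le_sqrt s
  set N := Real.sqrt (1 + s ^ 2)
  by_contra hnot
  -- separation
  have hK : IsCompact ((fun c : Pt d => (c.1 : E d)) '' (plane v ∩ C)) := by
    have : (fun c : Pt d => (c.1 : E d)) '' (plane v ∩ C)
        = ((fun c : Pt d => (c.1 : E d)) '' C) ∩ {x | mink d v x = 0} := by
      ext x
      constructor
      · rintro ⟨c, ⟨h1, h2⟩, rfl⟩
        exact ⟨⟨c, h2, rfl⟩, h1⟩
      · rintro ⟨⟨c, h2, rfl⟩, h1⟩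
        exact ⟨c, ⟨h1, h2⟩, rfl⟩
    rw [this]
    exact hX.inter_right (isClosed_eq (c1 v) continuous_const)
  obtain ⟨u, hu1, hu2⟩ := separate hK (by
    intro a ha b hb α β hα hβ hab
    obtain ⟨q, hq, l, hl, e⟩ := combo hC.1 ha.2 hb.2 hα hβ hab
    refine ⟨q, ⟨?_, hq⟩, l, hl, e⟩
    have h1 : mink d v (l • q.1) = 0 := by
      have ea : mink d v a.1 = 0 := ha.1
      have eb : mink d v b.1 = 0 := hb.1
      rw [← e, mink_add_right, mink_smul_right, mink_smul_right, ea, eb]; ring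
    rw [mink_smul_right] at h1
    exact (mul_eq_zero.1 h1).resolve_left hl.ne') h (fun hh => hnot hh.2)
  obtain ⟨B, hB⟩ : ∃ B, B = mink d v u := ⟨_, rfl⟩
  obtain ⟨Q, hQ⟩ : ∃ Q, Q = mink d u u := ⟨_, rfl⟩
  obtain ⟨η, hη⟩ : ∃ η, η = -(N * mink d u h.1) / 2 := ⟨_, rfl⟩
  have hη0 : 0 < η := by rw [hη]; nlinarith
  have huj : mink d u j.1 - s * B = -2 * η := by
    have : mink d u (j.1 - s • v) = N * mink d u h.1 := by rw [hfoot, mink_smul_right]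
    rw [mink_sub_right, mink_smul_right, mink_comm u v, ← hB] at this
    rw [this, hη]; ring
  obtain ⟨t1, ht1, H1⟩ := small_t hX (c1 v) (c1 u)
    (by rintro _ ⟨c, hc, rfl⟩; exact hside c hc)
    (by rintro _ ⟨c, hc, rfl⟩ h0; exact hu2 c ⟨h0, hc⟩)
  obtain ⟨t2, ht2, H2⟩ := small_t hX (f := fun y => s - mink d v y)
    (g := fun y => s * B - mink d u y - η)
    (continuous_const.sub (c1 v)) ((continuous_const.sub (c1 u)).sub continuous_const)
    (by rintro _ ⟨c, hc, rfl⟩; exact sub_nonneg.2 (hle c hc))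
    (by
      rintro _ ⟨c, hc, rfl⟩ h0
      have := huq c hc (by simp only at h0; linarith)
      rw [this]
      linarith)
  obtain ⟨G, hG⟩ : ∃ G, G = |(s * B - η) ^ 2 - s ^ 2 * Q| + 1 := ⟨_, rfl⟩
  have hG0 : 0 < G := by rw [hG]; positivity
  obtain ⟨t, ht0, ht⟩ : ∃ t, 0 < t ∧ t < min t1 (min t2 (2 * s * η / G)) :=
    exists_between (by positivity)
  have a1 : t < t1 := ht.trans_le (min_le_left _ _)
  have a2 : t < t2 := ht.trans_le ((min_le_right _ _).trans (min_le_left _ _))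
  have a3 : t < 2 * s * η / G := ht.trans_le ((min_le_right _ _).trans (min_le_right _ _))
  rw [lt_div_iff₀ hG0] at a3
  set z : E d := v + t • u with hz
  have hzc : ∀ c : Pt d, mink d z c.1 = mink d v c.1 + t * mink d u c.1 := by
    intro c; rw [hz, mink_add_left, mink_smul_left]
  have hzz : mink d z z = 1 + 2 * t * B + t ^ 2 * Q := by
    simp only [hz, mink_add_left, mink_add_right, mink_smul_left, mink_smul_right, hv,
      mink_comm u v, ← hB, ← hQ]
    ring
  obtain ⟨M, hM⟩ : ∃ M, M = s + t * (s * B - η) := ⟨_, rfl⟩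
  have hz0 : ∀ c ∈ C, 0 ≤ mink d z c.1 := by
    intro c hc
    rw [hzc]; exact H1 t ht0 a1 _ ⟨c, hc, rfl⟩
  have hzM : ∀ c ∈ C, mink d z c.1 ≤ M := by
    intro c hc
    have : 0 ≤ s - mink d v c.1 + t * (s * B - mink d u c.1 - η) := H2 t ht0 a2 _ ⟨c, hc, rfl⟩
    rw [hzc, hM]; linarith
  have hlt : M ^ 2 < s ^ 2 * mink d z z := by
    rw [hzz, hM]
    have : (s * B - η) ^ 2 - s ^ 2 * Q ≤ G := by rw [hG]; linarith [le_abs_self ((s * B - η) ^ 2 - s ^ 2 * Q)]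
    have : t * ((s * B - η) ^ 2 - s ^ 2 * Q) < 2 * s * η := by nlinarith
    nlinarith
  have hzpos : 0 < mink d z z := by
    by_contra hc
    push Not at hc
    nlinarith [sq_nonneg M, sq_nonneg s, mul_nonneg (sq_nonneg s) (neg_nonneg.2 hc)]
  have hfin := thickness_le hX hjC z hzpos hz0 hzM
  rw [← hmin, ← hjfar, distPS_eq v hv, arc_le, ← hs, div_pow, Real.sq_sqrt hzpos.le,
    le_div_iff₀ hzpos] at hfin
  linarith

/-- Theorem 2: if `width_H(C) = Δ(C)` and the farthest point `j`
of `C` from `H` is unique, then the projection of `j` onto `H` lies in `H ∩ C`. -/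
theorem proj_of_unique_farthest_mem {d : ℕ} (C : Set (Pt d)) (hC : IsBody C)
    (H : Set (Pt d)) (hH : Supports H C) (hmin : width H C = thickness C)
    (j : Pt d) (hjC : j ∈ C) (hjfar : distPS j H = width H C)
    (huniq : ∀ j' ∈ C, distPS j' H = width H C → j' = j)
    (h : Pt d) (hproj : IsProj j H h) :
    h ∈ H ∩ C := by
  obtain ⟨v, hv, rfl⟩ := hH.1
  refine ⟨hproj.1, ?_⟩
  obtain ⟨p, hp⟩ := hC.2.2.2
  have hne : mink d v p.1 ≠ 0 := fun h0 => hH.2.2 p hp h0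
  rcases lt_or_gt_of_ne hne with hlt | hgt
  · rw [← plane_neg v] at hH hmin hjfar huniq hproj
    exact main_aux hC (-v) (by rw [mink_neg_left, mink_neg_right, hv]; norm_num) hH hmin j hjC hjfar
      huniq h hproj p hp (by rw [mink_neg_left]; linarith)
  · exact main_aux hC v hv hH hmin j hjC hjfar huniq h hproj p hp hgt

end HypSpace
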